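/- Let y₀ ∈ ℝⁿ and set y(t) = Φ(t,t₀)·y₀, p(t) = P(t)·y(t), and u(t) = −N(t)⁻¹·B(t)ᵀ·p(t). Then the pair (y,p) solves the forward–backward optimality system: y'(t) + A(t)·y(t) + B(t)·N(t)⁻¹·B(t)ᵀ·p(t) = 0 and −p'(t) + A(t)ᵀ·p(t) − M(t)·y(t) = 0 for all t ∈ [t₀,T], with y(t₀) = y₀ and p(T) = 0; in particular y'(t) = −A(t)·y(t) + B(t)·u(t), i.e. p(t) = P(t)y(t) is the decoupling property of the Riccati solution. -/

import Mathlib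

open Matrix Set

/-- Product rule for the matrix-vector product, with the matrix differentiated entrywise. -/
theorem hasDerivAt_mulVec {k l : Type*} [Fintype k] [Fintype l]
    {F : ℝ → Matrix k l ℝ} {F' : Matrix k l ℝ} {v : ℝ → l → ℝ} {v' : l → ℝ} {t : ℝ}
    (hF : ∀ i j, HasDerivAt (fun τ => F τ i j) (F' i j) t) (hv : HasDerivAt v v' t) :
    HasDerivAt (fun τ => F τ *ᵥ v τ) (F' *ᵥ v t + F t *ᵥ v') t := by
  refine hasDerivAt_pi.2 fun i => ?_
  simp only [Pi.add_apply, mulVec, dotProduct, ← Finset.sum_add_distrib]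
  exact HasDerivAt.fun_sum fun j _ => (hF i j).mul (hasDerivAt_pi.1 hv j)

/-- Decoupling property: with `y(t) = Φ(t,t₀)y₀`,
`p(t) = P(t)y(t)` and `u(t) = −N(t)⁻¹B(t)ᵀp(t)`, the pair `(y,p)` solves the
forward–backward optimality system of the LQR, and `y' = −Ay + Bu`. -/
theorem stmt_7
    {n m : ℕ} {t₀ T : ℝ} (htT : t₀ < T)
    (A M : ℝ → Matrix (Fin n) (Fin n) ℝ)
    (B : ℝ → Matrix (Fin n) (Fin m) ℝ)
    (N : ℝ → Matrix (Fin m) (Fin m) ℝ)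
    (hA : ContinuousOn A (Icc t₀ T)) (hM : ContinuousOn M (Icc t₀ T))
    (hB : ContinuousOn B (Icc t₀ T)) (hN : ContinuousOn N (Icc t₀ T))
    (hMpsd : ∀ t ∈ Icc t₀ T, (M t).PosSemidef)
    (hNpd : ∀ t ∈ Icc t₀ T, (N t).PosDef)
    (P : ℝ → Matrix (Fin n) (Fin n) ℝ)
    (hP : ∀ t ∈ Icc t₀ T, ∀ i j, HasDerivAt (fun τ => P τ i j)
      ((P t * A t + (A t)ᵀ * P t + P t * B t * (N t)⁻¹ * (B t)ᵀ * P t - M t) i j) t)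
    (hPT : P T = 0)
    (Φ : ℝ → ℝ → Matrix (Fin n) (Fin n) ℝ)
    (hΦ0 : ∀ s ∈ Icc t₀ T, Φ s s = 1)
    (hΦt : ∀ s ∈ Icc t₀ T, ∀ t ∈ Icc t₀ T, ∀ i j,
      HasDerivAt (fun τ => Φ τ s i j)
        ((-((A t + B t * (N t)⁻¹ * (B t)ᵀ * P t) * Φ t s)) i j) t)
    (hΦs : ∀ t ∈ Icc t₀ T, ∀ s ∈ Icc t₀ T, ∀ i j,
      HasDerivAt (fun σ => Φ t σ i j)
        ((Φ t s * (A s + B s * (N s)⁻¹ * (B s)ᵀ * P s)) i j) s)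
    (y₀ : Fin n → ℝ)
    (y p : ℝ → Fin n → ℝ) (u : ℝ → Fin m → ℝ)
    (hy : ∀ t, y t = Φ t t₀ *ᵥ y₀)
    (hp : ∀ t, p t = P t *ᵥ y t)
    (hu : ∀ t, u t = -((N t)⁻¹ *ᵥ ((B t)ᵀ *ᵥ p t))) :
    (∀ t ∈ Icc t₀ T,
      HasDerivAt y (-(A t *ᵥ y t) - (B t * (N t)⁻¹ * (B t)ᵀ) *ᵥ p t) t) ∧
    (∀ t ∈ Icc t₀ T,
      HasDerivAt p ((A t)ᵀ *ᵥ p t - M t *ᵥ y t) t) ∧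
    y t₀ = y₀ ∧ p T = 0 ∧
    (∀ t ∈ Icc t₀ T,
      HasDerivAt y (-(A t *ᵥ y t) + B t *ᵥ u t) t) := by
  have ht₀ : t₀ ∈ Icc t₀ T := left_mem_Icc.2 htT.le
  have hy' : ∀ t ∈ Icc t₀ T,
      HasDerivAt y (-(A t *ᵥ y t) - (B t * (N t)⁻¹ * (B t)ᵀ) *ᵥ p t) t := by
    intro t ht
    rw [funext hy]
    convert hasDerivAt_mulVec (hΦt t₀ ht₀ t ht) (hasDerivAt_const t y₀) using 1
    simp only [hp, hy, mulVec_zero, add_zero, mulVec_mulVec, neg_mulVec, add_mulVec, add_mul,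
      neg_add, Matrix.mul_assoc, sub_eq_add_neg]
  refine ⟨hy', fun t ht => ?_, ?_, ?_, fun t ht => ?_⟩
  · rw [funext hp]
    convert hasDerivAt_mulVec (hP t ht) (hy' t ht) using 1
    simp only [hp, mulVec_mulVec, sub_mulVec, add_mulVec, mulVec_sub, mulVec_neg,
      Matrix.mul_assoc]
    abel
  · rw [hy, hΦ0 t₀ ht₀, one_mulVec]
  · rw [hp, hPT, zero_mulVec]
  · convert hy' t ht using 1
    simp only [hu, mulVec_neg, mulVec_mulVec, Matrix.mul_assoc, sub_eq_add_neg]
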